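/- arXiv:1209.0882 — 6 statements merged into one kernel-verified Lean document; each statement's English description precedes it below -/
import Mathlib

section
/- Let ω, η ∈ ℕ with ω, η ≥ 1, and let γ = (γ_u)_{u∈𝒰} be finite-order weights of order ω such that for every k ∈ ℕ one has |{u ∈ 𝒰 : γ_u > 0 and k ∈ u}| ≤ η. Then there exists a map φ : ℕ → {1, 2, …, η(ω−1)+1} such that for every u ∈ 𝒰 with γ_u > 0 the restriction of φ to u is injective. -/
/-- Greedy colouring: if every `k : ℕ` has at most `D` designated neighbours, then `D + 1` colours
suffice to give each `k` a colour different from those of its smaller neighbours. -/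
theorem exists_greedy_colouring (N : ℕ → Finset ℕ) (D : ℕ) (hN : ∀ k, (N k).card ≤ D) :
    ∃ φ : ℕ → ℕ, (∀ k, 1 ≤ φ k ∧ φ k ≤ D + 1) ∧ ∀ k, ∀ j ∈ N k, j < k → φ j ≠ φ k := by
  have avoid : ∀ s : Finset ℕ, ∃ c, s.card ≤ D → c ∈ Finset.Icc 1 (D + 1) ∧ c ∉ s := by
    intro s
    by_cases hs : s.card ≤ D
    · obtain ⟨c, hc, hcs⟩ := Finset.exists_mem_notMem_of_card_lt_card
        (s := s) (t := Finset.Icc 1 (D + 1)) (by simp; omega)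
      exact ⟨c, fun _ => ⟨hc, hcs⟩⟩
    · exact ⟨0, fun h => absurd h hs⟩
  choose g hg using avoid
  let F : (k : ℕ) → ((j : ℕ) → j < k → ℕ) → ℕ := fun k f =>
    g ((N k).image fun j => if h : j < k then f j h else 0)
  let φ : ℕ → ℕ := (Nat.lt_wfRel.wf).fix F
  have hφ : ∀ k, φ k = g ((N k).image fun j => if j < k then φ j else 0) := by
    intro k
    exact (Nat.lt_wfRel.wf).fix_eq F k
  have hcol := fun k => hg ((N k).image fun j => if j < k then φ j else 0)
    (Finset.card_image_le.trans (hN k))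
  refine ⟨φ, fun k => ?_, fun k j hj hjk heq => ?_⟩
  · rw [hφ k]
    exact Finset.mem_Icc.mp (hcol k).1
  · apply (hcol k).2
    rw [← hφ k, Finset.mem_image]
    exact ⟨j, hj, by rw [if_pos hjk, heq]⟩


/-- For finite-order weights `γ` of order `ω ≥ 1` such that every `k ∈ ℕ` belongs to at most
`η ≥ 1` sets of positive weight, there is a map `φ : ℕ → {1, …, η(ω−1)+1}` whose restriction
to every set `u` of positive weight is injective. -/
theorem exists_injective_colouring
    (γ : Finset ℕ → ℝ) (hnn : ∀ u, 0 ≤ γ u) (ω η : ℕ) (hω : 1 ≤ ω) (hη : 1 ≤ η)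
    (horder : ∀ u : Finset ℕ, ω < u.card → γ u = 0)
    (hpt : ∀ k : ℕ, {u : Finset ℕ | 0 < γ u ∧ k ∈ u}.Finite ∧
      {u : Finset ℕ | 0 < γ u ∧ k ∈ u}.ncard ≤ η) :
    ∃ φ : ℕ → ℕ, (∀ k, 1 ≤ φ k ∧ φ k ≤ η * (ω - 1) + 1) ∧
      ∀ u : Finset ℕ, 0 < γ u → Set.InjOn φ ↑u := by
  classical
  let N : ℕ → Finset ℕ := fun k => (hpt k).1.toFinset.biUnion fun u => u.erase k
  have hN : ∀ k, (N k).card ≤ η * (ω - 1) := by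
    intro k
    have hS : (hpt k).1.toFinset.card ≤ η := by
      rw [← Set.ncard_eq_toFinset_card _ (hpt k).1]
      exact (hpt k).2
    refine (Finset.card_biUnion_le_card_mul _ _ (ω - 1) fun u hu => ?_).trans
      (Nat.mul_le_mul_right _ hS)
    obtain ⟨hpos, hk⟩ := (hpt k).1.mem_toFinset.mp hu
    rw [Finset.card_erase_of_mem hk]
    exact Nat.sub_le_sub_right (not_lt.mp fun h => hpos.ne' (horder u h)) 1
  obtain ⟨φ, hrange, hne⟩ := exists_greedy_colouring N _ hN
  have mem_N : ∀ u, 0 < γ u → ∀ a ∈ u, ∀ b ∈ u, a ≠ b → a ∈ N b := fun u hu a ha b hb hab =>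
    Finset.mem_biUnion.mpr
      ⟨u, (hpt b).1.mem_toFinset.mpr ⟨hu, hb⟩, Finset.mem_erase.mpr ⟨hab, ha⟩⟩
  refine ⟨φ, hrange, fun u hu a ha b hb hab => ?_⟩
  rcases lt_trichotomy a b with h | h | h
  · exact absurd hab (hne b a (mem_N u hu a ha b hb h.ne) h)
  · exact h
  · exact absurd hab.symm (hne a b (mem_N u hu b hb a ha h.ne) h)
end

section
/- Let η ∈ ℕ, let (u_j)_{j∈ℕ} be a sequence of pairwise distinct nonempty finite subsets of ℕ such that every k ∈ ℕ belongs to at most η of the sets u_j, and let (a_j)_{j∈ℕ} be a nonincreasing sequence of nonnegative reals with Σ_{j∈ℕ} a_j < ∞. Then for every nonempty finite subset v ⊂ ℕ one has Σ_{j : u_j ∩ v = ∅} a_j ≥ η·|v|·a_{2η|v|}. -/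
/-- If every `k` lies in at most `η` of the sets `u j`, then any finite set of indices contains at
most `η * v.card` indices `j` for which `u j` meets `v`. -/
lemma card_filter_inter_ne_empty_le {ι α : Type*} [DecidableEq α] {η : ℕ} {u : ι → Finset α}
    (hη : ∀ k, {j | k ∈ u j}.Finite ∧ {j | k ∈ u j}.ncard ≤ η) (s : Finset ι) (v : Finset α) :
    (s.filter fun j => ¬ u j ∩ v = ∅).card ≤ η * v.card := by
  classical
  have hsub : (s.filter fun j => ¬ u j ∩ v = ∅) ⊆ v.biUnion fun k => (hη k).1.toFinset := by
    intro j hj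
    obtain ⟨k, hk⟩ := Finset.nonempty_iff_ne_empty.mpr (Finset.mem_filter.mp hj).2
    rw [Finset.mem_inter] at hk
    exact Finset.mem_biUnion.mpr ⟨k, hk.2, by simpa using hk.1⟩
  rw [mul_comm]
  refine (Finset.card_le_card hsub).trans (Finset.card_biUnion_le_card_mul _ _ _ fun k _ => ?_)
  rw [← Set.ncard_eq_toFinset_card _ (hη k).1]
  exact (hη k).2


/-- Let `(u_j)` be pairwise distinct nonempty finite subsets of `ℕ` such that every `k ∈ ℕ`
belongs to at most `η` of them, and let `(a_j)` be a nonincreasing summable sequence of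
nonnegative reals.  Then for every nonempty finite `v ⊂ ℕ` the sum of the `a_j` over the
indices `j` with `u_j ∩ v = ∅` is at least `η · |v| · a_{2η|v|}`. -/
theorem tail_sum_lower_bound
    (η : ℕ) (u : ℕ → Finset ℕ) (hinj : Function.Injective u)
    (hne : ∀ j, (u j).Nonempty)
    (hη : ∀ k : ℕ, {j : ℕ | k ∈ u j}.Finite ∧ {j : ℕ | k ∈ u j}.ncard ≤ η)
    (a : ℕ → ℝ) (hmono : Antitone a) (hnn : ∀ j, 0 ≤ a j) (hsum : Summable a) :
    ∀ v : Finset ℕ, v.Nonempty →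
      (η * v.card : ℝ) * a (2 * η * v.card) ≤ ∑' j : {j : ℕ // u j ∩ v = ∅}, a j := by
  intro v _
  set N := 2 * η * v.card with hN
  set F := (Finset.range N).filter fun j => u j ∩ v = ∅ with hF
  have hcard : η * v.card ≤ F.card := by
    have h₁ := card_filter_inter_ne_empty_le hη (Finset.range N) v
    have h₂ := Finset.card_filter_add_card_filter_not (s := Finset.range N)
      (fun j => u j ∩ v = ∅)
    rw [Finset.card_range] at h₂
    have h₃ : N = η * v.card + η * v.card := by rw [hN]; ring
    rw [hF]
    omega
  calc (η * v.card : ℝ) * a N ≤ F.card * a N := by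
        gcongr
        · exact hnn N
        · exact_mod_cast hcard
    _ ≤ ∑ j ∈ F, a j := by
        rw [← nsmul_eq_mul]
        refine Finset.card_nsmul_le_sum _ _ _ fun j hj => hmono ?_
        exact (Finset.mem_range.mp (Finset.mem_filter.mp hj).1).le
    _ = ∑ j ∈ (Finset.range N).subtype (fun j => u j ∩ v = ∅), a j :=
        (Finset.sum_subtype_eq_sum_filter _).symm
    _ ≤ ∑' j : {j : ℕ // u j ∩ v = ∅}, a j :=
        (hsum.subtype {j | u j ∩ v = ∅}).sum_le_tsum _ fun j _ => hnn j
end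

section
/- Let (D,Σ',ρ) be a probability space, let k : D×D → ℝ be measurable with k(x,x) ≥ 0 for all x ∈ D and M := ∫_D k(x,x) ρ(dx) < ∞, and let (γ_u)_{u∈𝒰} be nonnegative weights with Σ_{u∈𝒰} γ_u · M^{|u|} < ∞. Let μ := ⊗_{n∈ℕ} ρ be the product probability measure on D^ℕ. Then the set 𝒳 := { x ∈ D^ℕ : Σ_{u∈𝒰} γ_u · Π_{j∈u} k(x_j,x_j) < ∞ } satisfies μ(𝒳) = 1. -/
open MeasureTheory

/-- If finitely many coordinates have joint law `Measure.pi ρ`, the product of an integrable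
function along them is integrable, with integral the corresponding power. -/
theorem integrable_prod_and_integral_eq_pow {ι D : Type*} [MeasurableSpace D] {ρ : Measure D}
    [IsProbabilityMeasure ρ] {μ : Measure (ι → D)} {f : D → ℝ} (hf : Integrable f ρ)
    (u : Finset ι)
    (hμ : Measure.map (fun (x : ι → D) (j : {i // i ∈ u}) => x j.1) μ =
      Measure.pi (fun _ : {i // i ∈ u} => ρ)) :
    Integrable (fun x => ∏ j ∈ u, f (x j)) μ ∧
      ∫ x, ∏ j ∈ u, f (x j) ∂μ = (∫ x, f x ∂ρ) ^ u.card := by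
  have hmeas : Measurable (fun (x : ι → D) (j : {i // i ∈ u}) => x j.1) := by fun_prop
  have hprod : Integrable (fun y : {i // i ∈ u} → D => ∏ j, f (y j))
      (Measure.map (fun (x : ι → D) (j : {i // i ∈ u}) => x j.1) μ) := by
    rw [hμ]
    exact Integrable.fintype_prod (fun _ => hf)
  have heq (x : ι → D) : ∏ j : {i // i ∈ u}, f (x j.1) = ∏ j ∈ u, f (x j) :=
    Finset.prod_coe_sort u (fun j => f (x j))
  constructor
  · simpa only [Function.comp_def, heq] using hprod.comp_measurable hmeas
  · have h := integral_map hmeas.aemeasurable hprod.aestronglyMeasurable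
    simp only [heq] at h
    rw [← h, hμ, integral_fintype_prod_eq_pow, Fintype.card_coe]

/-- A countable family of nonnegative integrable functions with summable integrals is
almost everywhere summable. -/
theorem ae_summable_of_summable_integral {ι Ω : Type*} [Countable ι] [MeasurableSpace Ω]
    {μ : Measure Ω} {F : ι → Ω → ℝ} (hF : ∀ i, Integrable (F i) μ) (hnn : ∀ i x, 0 ≤ F i x)
    (hsum : Summable (fun i => ∫ x, F i x ∂μ)) :
    ∀ᵐ x ∂μ, Summable (fun i => F i x) := by
  have hmeas (i : ι) : AEMeasurable (fun x => ENNReal.ofReal (F i x)) μ :=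
    (hF i).aestronglyMeasurable.aemeasurable.ennreal_ofReal
  have hfin : ∫⁻ x, ∑' i, ENNReal.ofReal (F i x) ∂μ ≠ ⊤ := by
    rw [lintegral_tsum hmeas]
    simp_rw [← ofReal_integral_eq_lintegral_ofReal (hF _) (Filter.Eventually.of_forall (hnn _))]
    exact hsum.tsum_ofReal_ne_top
  filter_upwards [ae_lt_top' (AEMeasurable.tsum hmeas) hfin] with x hx
  simpa only [ENNReal.toReal_ofReal (hnn _ x)] using ENNReal.summable_toReal hx.ne

/-- Let `(D,Σ',ρ)` be a probability space, `k` a measurable kernel with `k(x,x) ≥ 0` and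
`M := ∫ k(x,x) dρ < ∞`, and let `(γ_u)` be nonnegative weights with
`Σ_u γ_u M^{|u|} < ∞`.  If `μ` is the product probability measure `⊗_{n∈ℕ} ρ` on `D^ℕ`
(characterized by the fact that all its finite-dimensional marginals are products of `ρ`),
then the set `𝒳 = {x ∈ D^ℕ : Σ_u γ_u Π_{j∈u} k(x_j,x_j) < ∞}` has full measure. -/
theorem domain_has_full_measure
    {D : Type*} [MeasurableSpace D] (ρ : Measure D) [IsProbabilityMeasure ρ]
    (k : D → D → ℝ) (hk : Measurable (Function.uncurry k)) (hknn : ∀ x, 0 ≤ k x x)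
    (hint : Integrable (fun x => k x x) ρ)
    (γ : Finset ℕ → ℝ) (hnn : ∀ u, 0 ≤ γ u)
    (hsum : Summable (fun u : Finset ℕ => γ u * (∫ x, k x x ∂ρ) ^ u.card))
    (μ : Measure (ℕ → D)) [IsProbabilityMeasure μ]
    (hμ : ∀ s : Finset ℕ,
      Measure.map (fun (x : ℕ → D) (j : {i // i ∈ s}) => x j.1) μ =
        Measure.pi (fun _ : {i // i ∈ s} => ρ)) :
    μ {x : ℕ → D | Summable (fun u : Finset ℕ => γ u * ∏ j ∈ u, k (x j) (x j))} = 1 := by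
  have hprod (u : Finset ℕ) := integrable_prod_and_integral_eq_pow hint u (hμ u)
  have hae := ae_summable_of_summable_integral (μ := μ)
    (F := fun (u : Finset ℕ) x => γ u * ∏ j ∈ u, k (x j) (x j))
    (fun u => (hprod u).1.const_mul (γ u))
    (fun u x => mul_nonneg (hnn u) (Finset.prod_nonneg fun j _ => hknn (x j)))
    (by simpa only [integral_const_mul, (hprod _).2] using hsum)
  exact (measure_congr (Filter.eventuallyEq_univ.mpr hae)).trans measure_univ
end

section
/- Let m ∈ ℕ, τ > 0, S > 0, σ_k > 0 and c_k > 0 for k = 1,…,m, and let x*_k := C̃ · σ_k^{1/(τ+1)} · c_k^{−1/(τ+1)} with C̃ := S · (Σ_{k=1}^m σ_k^{1/(τ+1)} c_k^{τ/(τ+1)})^{−1}. Put n_k := ⌈x*_k⌉. Then Σ_{k=1}^m σ_k n_k^{−τ} ≤ S^{−τ} · (Σ_{k=1}^m σ_k^{1/(τ+1)} c_k^{τ/(τ+1)})^{τ+1} and Σ_{k=1}^m n_k c_k ≤ S + Σ_{k=1}^m c_k. -/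
/-- The cost `x * c` of the minimizer `x = A σ^{1/(τ+1)} c^{-1/(τ+1)}`. -/
theorem minimizer_mul_cost {τ A s c : ℝ} (hτ : 0 < τ) (hc : 0 < c) :
    A * (s ^ (1 / (τ + 1)) * c ^ (-(1 / (τ + 1)))) * c =
      A * (s ^ (1 / (τ + 1)) * c ^ (τ / (τ + 1))) := by
  have h : c ^ (-(1 / (τ + 1))) * c = c ^ (τ / (τ + 1)) := by
    rw [← Real.rpow_add_one hc.ne']
    congr 1
    field_simp
    ring
  rw [← h]
  ring

/-- The error `σ * x^{-τ}` of the minimizer `x = A σ^{1/(τ+1)} c^{-1/(τ+1)}`. -/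
theorem mul_minimizer_rpow_neg {τ A s c : ℝ} (hτ : 0 < τ) (hA : 0 < A) (hs : 0 < s)
    (hc : 0 < c) :
    s * (A * (s ^ (1 / (τ + 1)) * c ^ (-(1 / (τ + 1))))) ^ (-τ) =
      A ^ (-τ) * (s ^ (1 / (τ + 1)) * c ^ (τ / (τ + 1))) := by
  rw [Real.mul_rpow hA.le (by positivity), Real.mul_rpow (by positivity) (by positivity),
    ← Real.rpow_mul hs.le, ← Real.rpow_mul hc.le]
  have h_s : s * s ^ (1 / (τ + 1) * -τ) = s ^ (1 / (τ + 1)) := by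
    rw [← Real.rpow_one_add' hs.le (by field_simp; ring_nf; positivity)]
    congr 1
    field_simp
    ring
  have h_c : -(1 / (τ + 1)) * -τ = τ / (τ + 1) := by ring
  rw [h_c, ← h_s]
  ring

/-- Rounding the constrained minimizer: with `T = Σ_k σ_k^{1/(τ+1)} c_k^{τ/(τ+1)}`,
`x*_k = (S/T) · σ_k^{1/(τ+1)} · c_k^{−1/(τ+1)}` and `n_k = ⌈x*_k⌉`, one has
`Σ_k σ_k n_k^{−τ} ≤ S^{−τ} T^{τ+1}` and `Σ_k n_k c_k ≤ S + Σ_k c_k`. -/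
theorem rounded_minimizer
    (m : ℕ) (hm : 0 < m) (τ S : ℝ) (hτ : 0 < τ) (hS : 0 < S)
    (σ c : Fin m → ℝ) (hσ : ∀ k, 0 < σ k) (hc : ∀ k, 0 < c k)
    (T : ℝ) (hT : T = ∑ l, σ l ^ (1 / (τ + 1)) * c l ^ (τ / (τ + 1)))
    (xstar : Fin m → ℝ)
    (hxstar : ∀ k, xstar k = S / T * (σ k ^ (1 / (τ + 1)) * c k ^ (-(1 / (τ + 1)))))
    (n : Fin m → ℕ) (hn : ∀ k, n k = ⌈xstar k⌉₊) :
    (∑ k, σ k * (n k : ℝ) ^ (-τ) ≤ S ^ (-τ) * T ^ (τ + 1)) ∧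
    (∑ k, (n k : ℝ) * c k ≤ S + ∑ k, c k) := by
  have hT_pos : 0 < T := by
    rw [hT]
    exact Finset.sum_pos (fun k _ => mul_pos (Real.rpow_pos_of_pos (hσ k) _)
      (Real.rpow_pos_of_pos (hc k) _)) ⟨⟨0, hm⟩, Finset.mem_univ _⟩
  have hA : 0 < S / T := div_pos hS hT_pos
  have hx : ∀ k, 0 < xstar k := fun k => by
    have := hσ k
    have := hc k
    rw [hxstar]
    positivity
  constructor
  · calc ∑ k, σ k * (n k : ℝ) ^ (-τ)
        ≤ ∑ k, σ k * xstar k ^ (-τ) := by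
          refine Finset.sum_le_sum fun k _ => mul_le_mul_of_nonneg_left ?_ (hσ k).le
          refine Real.rpow_le_rpow_of_nonpos (hx k) ?_ (by linarith)
          rw [hn]
          exact Nat.le_ceil _
      _ = (S / T) ^ (-τ) * T := by
          rw [hT, Finset.mul_sum, ← hT]
          refine Finset.sum_congr rfl fun k _ => ?_
          rw [hxstar, mul_minimizer_rpow_neg hτ hA (hσ k) (hc k)]
      _ = S ^ (-τ) * T ^ (τ + 1) := by
          rw [Real.div_rpow hS.le hT_pos.le, Real.rpow_neg hT_pos.le, div_inv_eq_mul,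
            Real.rpow_add_one hT_pos.ne', mul_assoc]
  · calc ∑ k, (n k : ℝ) * c k
        ≤ ∑ k, (xstar k * c k + c k) := by
          refine Finset.sum_le_sum fun k _ => ?_
          rw [← add_one_mul, hn]
          exact mul_le_mul_of_nonneg_right (Nat.ceil_lt_add_one (hx k).le).le (hc k).le
      _ = S / T * T + ∑ k, c k := by
          rw [Finset.sum_add_distrib]
          congr 1
          rw [hT, Finset.mul_sum, ← hT]
          refine Finset.sum_congr rfl fun k _ => ?_
          rw [hxstar, minimizer_mul_cost hτ (hc k)]
      _ = S + ∑ k, c k := by rw [div_mul_cancel₀ _ hT_pos.ne']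
end

section
/- Let γ = (γ_u)_{u∈𝒰} be finite-order weights of order ω that are finite-intersection weights with intersection degree at most ρ, and assume the monotonicity condition γ_u ≥ γ_v for all u, v ∈ 𝒰 with u ⊆ v and γ_u > 0. Let c ≥ 0 be a real number. Then for all u, v ∈ 𝒰 with ∅ ≠ u ⊆ v and γ_u > 0 one has Σ_{w ∈ 𝒰, w ⊆ ℕ∖v} γ_{u∪w} · c^{|w|} ≤ γ_u · (1+ρ) · max{1, c^ω}. -/
/-- For monotone finite-intersection weights of order `ω` with intersection degree at most
`ρ`, and any real `c ≥ 0`, one has, for all `∅ ≠ u ⊆ v` with `γ_u > 0`,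
`Σ_{w ⊆ ℕ∖v} γ_{u∪w} c^{|w|} ≤ γ_u · (1+ρ) · max{1, c^ω}`. -/
theorem monotone_fiw_tail_bound
    (γ : Finset ℕ → ℝ) (hnn : ∀ u, 0 ≤ γ u) (ω ρ : ℕ)
    (horder : ∀ u : Finset ℕ, ω < u.card → γ u = 0)
    (hfi : ∀ u : Finset ℕ, 0 < γ u →
      {v : Finset ℕ | 0 < γ v ∧ (u ∩ v).Nonempty}.Finite ∧
      {v : Finset ℕ | 0 < γ v ∧ (u ∩ v).Nonempty}.ncard ≤ 1 + ρ)
    (hmono : ∀ u v : Finset ℕ, u ⊆ v → 0 < γ u → γ v ≤ γ u)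
    (c : ℝ) (hc : 0 ≤ c) :
    ∀ u v : Finset ℕ, u.Nonempty → u ⊆ v → 0 < γ u →
      (∑' w : {w : Finset ℕ // Disjoint w v}, γ (u ∪ ↑w) * c ^ (w : Finset ℕ).card)
        ≤ γ u * (1 + ρ : ℝ) * max 1 (c ^ ω) := by
  classical
  intro u v hu huv hγu
  obtain ⟨hfin, hcard⟩ := hfi u hγu
  have hinj : Function.Injective (fun w : {w : Finset ℕ // Disjoint w v} => u ∪ (w : Finset ℕ)) := by
    intro w₁ w₂ h
    apply Subtype.ext
    have h₁ := (w₁.2.mono_right huv).symm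
    have h₂ := (w₂.2.mono_right huv).symm
    rw [← Finset.union_sdiff_cancel_left h₁, ← Finset.union_sdiff_cancel_left h₂]
    exact congrArg (· \ u) h
  let s := hfin.toFinset.preimage _ hinj.injOn
  have hs : s.card ≤ 1 + ρ := by
    rw [Set.ncard_eq_toFinset_card _ hfin] at hcard
    exact (Finset.card_le_card_of_injOn _ (fun w hw => Finset.mem_preimage.1 hw)
      hinj.injOn).trans hcard
  have hzero : ∀ w ∉ s, γ (u ∪ ↑w) * c ^ (w : Finset ℕ).card = 0 := by
    intro w hw
    have hnot : ¬ 0 < γ (u ∪ ↑w) := fun hpos => hw <| Finset.mem_preimage.2 <|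
      hfin.mem_toFinset.2 ⟨hpos, by rwa [Finset.inter_eq_left.2 Finset.subset_union_left]⟩
    rw [le_antisymm (not_lt.1 hnot) (hnn _), zero_mul]
  have hterm : ∀ w ∈ s, γ (u ∪ ↑w) * c ^ (w : Finset ℕ).card ≤ γ u * max 1 (c ^ ω) := by
    intro w hw
    have hpos : 0 < γ (u ∪ ↑w) := (hfin.mem_toFinset.1 (Finset.mem_preimage.1 hw)).1
    have hle : (w : Finset ℕ).card ≤ ω :=
      (Finset.card_le_card Finset.subset_union_right).trans
        (not_lt.1 fun h => hpos.ne' (horder _ h))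
    have hpow : c ^ (w : Finset ℕ).card ≤ max 1 (c ^ ω) := by
      rcases le_total c 1 with h | h
      · exact le_max_of_le_left (pow_le_one₀ hc h)
      · exact le_max_of_le_right (pow_le_pow_right₀ h hle)
    exact mul_le_mul (hmono _ _ Finset.subset_union_left hγu) hpow (by positivity) hγu.le
  rw [tsum_eq_sum hzero]
  calc _ ≤ s.card • (γ u * max 1 (c ^ ω)) := Finset.sum_le_card_nsmul _ _ _ hterm
    _ = (s.card : ℝ) * (γ u * max 1 (c ^ ω)) := nsmul_eq_mul _ _
    _ ≤ (1 + ρ : ℝ) * (γ u * max 1 (c ^ ω)) := by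
        gcongr
        exact_mod_cast hs
    _ = _ := by ring
end

section
/- Let (D,Σ',ρ) be a probability space, d ∈ ℕ, f : D^d → ℝ bounded and measurable, and a ∈ D^d. Define the ANOVA terms f_u pointwise by the recursion f_∅(x) = ∫_{D^d} f dρ^d and f_u(x) = ∫_{D^{[d]∖u}} f(x_u,ω) ρ^{[d]∖u}(dω) − Σ_{t⊊u} f_t(x). For u ⊆ [d] define Ψ_u f(x) := f(x_u; a), where (x_u; a) ∈ D^d has j-th component x_j for j ∈ u and a_j otherwise. For t ⊆ w ⊆ [d] set f^+_{t,w} := Σ_{u''⊆[d]∖w} f_{t∪u''}, and for u ⊆ v ⊊ w set f^−_{u,v,w} := Σ_{u'⊆[d]∖v, u'∩w≠∅} f_{u∪u'}. Then for all v ⊊ w ⊆ [d] and all x ∈ D^d: Ψ_w f(x) − Ψ_v f(x) = Σ_{u⊆v} Σ_{∅≠u'⊆w∖v} Ψ_w(f^+_{u∪u',w})(x) − Σ_{u⊆v} Ψ_v(f^−_{u,v,w})(x). -/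
open MeasureTheory

/-- The ANOVA term `f_u` of `f : Ω^d → ℝ`, defined recursively by
`f_∅ = ∫ f dP^d` and
`f_u(x) = ∫ f(x_u, ω) dP^{[d]∖u}(ω) − Σ_{v ⊊ u} f_v(x)`.
(Since the integrand only depends on the coordinates outside `u`, integrating `ω` over the
full product `P^d` gives exactly the integral over `P^{[d]∖u}`.) -/
noncomputable def anova {Ω : Type*} [MeasurableSpace Ω] (P : Measure Ω) {d : ℕ}
    (f : (Fin d → Ω) → ℝ) (u : Finset (Fin d)) (x : Fin d → Ω) : ℝ :=
  (∫ ω, f (fun j => if j ∈ u then x j else ω j) ∂(Measure.pi fun _ : Fin d => P)) -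
    ∑ v ∈ (u.powerset.filter (· ≠ u)).attach, anova P f v.1 x
termination_by u.card
decreasing_by
  have hv := v.2
  simp only [Finset.mem_filter, Finset.mem_powerset] at hv
  exact Finset.card_lt_card (lt_of_le_of_ne hv.1 hv.2)


/-- The anchored projection `Ψ_u g (x) = g(x_u; a)`, replacing the coordinates outside `u`
by those of the anchor `a`. -/
def anchorProj {D : Type*} {d : ℕ} (a : Fin d → D) (u : Finset (Fin d))
    (g : (Fin d → D) → ℝ) (x : Fin d → D) : ℝ :=
  g fun j => if j ∈ u then x j else a j

/-- The ANOVA terms `f_v` with `v ⊆ u` sum to the integral of `f` over the coordinates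
outside `u`. -/
lemma sum_powerset_anova {D : Type*} [MeasurableSpace D] (ρ : Measure D) {d : ℕ}
    (f : (Fin d → D) → ℝ) (u : Finset (Fin d)) (x : Fin d → D) :
    ∑ v ∈ u.powerset, anova ρ f v x =
      ∫ ω, f (fun j => if j ∈ u then x j else ω j) ∂(Measure.pi fun _ : Fin d => ρ) := by
  have h := anova.eq_1 ρ f u x
  rw [Finset.sum_attach (u.powerset.filter (· ≠ u)) (fun v => anova ρ f v x),
    Finset.filter_ne'] at h
  rw [← Finset.add_sum_erase _ _ (Finset.mem_powerset_self u), h, sub_add_cancel]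

/-- A function on a product of probability spaces is the sum of its ANOVA terms. -/
lemma sum_anova {D : Type*} [MeasurableSpace D] (ρ : Measure D) [IsProbabilityMeasure ρ]
    {d : ℕ} (f : (Fin d → D) → ℝ) (x : Fin d → D) :
    ∑ u, anova ρ f u x = f x := by
  simpa using sum_powerset_anova ρ f Finset.univ x

/-- The ANOVA term `f_u` depends only on the coordinates in `u`. -/
lemma anova_congr {D : Type*} [MeasurableSpace D] (ρ : Measure D) {d : ℕ}
    (f : (Fin d → D) → ℝ) (u : Finset (Fin d)) {x y : Fin d → D}
    (h : ∀ j ∈ u, x j = y j) : anova ρ f u x = anova ρ f u y := by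
  induction u using Finset.strongInduction with
  | H u ih =>
    have hint (ω : Fin d → D) :
        (fun j => if j ∈ u then x j else ω j) = fun j => if j ∈ u then y j else ω j := by
      funext j
      split_ifs with hj
      exacts [h j hj, rfl]
    rw [anova, anova]
    simp only [hint]
    congr 1
    refine Finset.sum_congr rfl fun t _ => ?_
    have ht := t.2
    rw [Finset.mem_filter, Finset.mem_powerset] at ht
    exact ih t (ht.1.ssubset_of_ne ht.2) fun j hj => h j (ht.1 hj)

/-- Splitting a set `s` meeting `w ∖ v` into its parts in `v`, in `w ∖ v` and outside `w`. -/
lemma sum_union_union_powerset {α M : Type*} [Fintype α] [DecidableEq α] [AddCommMonoid M]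
    {v w : Finset α} (hvw : v ⊆ w) (F : Finset α → M) :
    ∑ u ∈ v.powerset, ∑ u' ∈ (w \ v).powerset.filter (· ≠ ∅), ∑ u'' ∈ wᶜ.powerset,
      F ((u ∪ u') ∪ u'') = ∑ s with (s ∩ (w \ v)).Nonempty, F s := by
  simp only [← Finset.sum_product']
  refine Finset.sum_nbij' (fun p => (p.1 ∪ p.2.1) ∪ p.2.2)
    (fun s => (s ∩ v, s ∩ (w \ v), s \ w)) ?_ ?_ ?_ ?_ ?_
  · rintro ⟨u, u', u''⟩ h
    simp only [Finset.mem_product, Finset.mem_filter, Finset.mem_powerset,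
      ← Finset.nonempty_iff_ne_empty] at h
    obtain ⟨-, ⟨hu', j, hj⟩, -⟩ := h
    simp only [Finset.mem_filter_univ]
    exact ⟨j, by grind⟩
  · intro s hs
    simp only [Finset.mem_filter_univ] at hs
    simp only [Finset.mem_product, Finset.mem_filter, Finset.mem_powerset,
      ← Finset.nonempty_iff_ne_empty]
    exact ⟨Finset.inter_subset_right, ⟨Finset.inter_subset_right, hs⟩, by grind [Finset.mem_compl]⟩
  · rintro ⟨u, u', u''⟩ h
    simp only [Finset.mem_product, Finset.mem_filter, Finset.mem_powerset,
      Finset.subset_iff, Finset.mem_compl] at h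
    simp only [Prod.mk.injEq]
    refine ⟨?_, ?_, ?_⟩ <;> ext j <;> grind
  · intro s _
    ext j
    grind
  · intros
    rfl

/-- Splitting a set `s` meeting `w ∖ v` into its parts inside and outside `v`. -/
lemma sum_union_powerset {α M : Type*} [Fintype α] [DecidableEq α] [AddCommMonoid M]
    (v w : Finset α) (F : Finset α → M) :
    ∑ u ∈ v.powerset, ∑ u' ∈ vᶜ.powerset.filter (fun u' => (u' ∩ w).Nonempty), F (u ∪ u') =
      ∑ s with (s ∩ (w \ v)).Nonempty, F s := by
  simp only [← Finset.sum_product']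
  refine Finset.sum_nbij' (fun p => p.1 ∪ p.2) (fun s => (s ∩ v, s \ v)) ?_ ?_ ?_ ?_ ?_
  · rintro ⟨u, u'⟩ h
    simp only [Finset.mem_product, Finset.mem_filter, Finset.mem_powerset,
      Finset.subset_iff, Finset.mem_compl] at h
    obtain ⟨-, hu', j, hj⟩ := h
    simp only [Finset.mem_filter_univ]
    exact ⟨j, by grind⟩
  · intro s hs
    simp only [Finset.mem_filter_univ] at hs
    obtain ⟨j, hj⟩ := hs
    simp only [Finset.mem_product, Finset.mem_filter, Finset.mem_powerset]
    exact ⟨Finset.inter_subset_right, by grind [Finset.mem_compl], j, by grind⟩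
  · rintro ⟨u, u'⟩ h
    simp only [Finset.mem_product, Finset.mem_filter, Finset.mem_powerset,
      Finset.subset_iff, Finset.mem_compl] at h
    simp only [Prod.mk.injEq]
    refine ⟨?_, ?_⟩ <;> ext j <;> grind
  · intro s _
    ext j
    grind
  · intros
    rfl

/-- For a bounded measurable `f : D^d → ℝ` with pointwise ANOVA terms `f_u`, anchored
projections `Ψ_u`, and with `f⁺_{t,w} = Σ_{u''⊆[d]∖w} f_{t∪u''}` and
`f⁻_{u,v,w} = Σ_{u'⊆[d]∖v, u'∩w≠∅} f_{u∪u'}`, one has, for all `v ⊊ w ⊆ [d]` and all `x`,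
`Ψ_w f(x) − Ψ_v f(x) = Σ_{u⊆v} Σ_{∅≠u'⊆w∖v} Ψ_w(f⁺_{u∪u',w})(x) − Σ_{u⊆v} Ψ_v(f⁻_{u,v,w})(x)`. -/
theorem anchorProj_sub_anchorProj_eq
    {D : Type*} [MeasurableSpace D] (ρ : Measure D) [IsProbabilityMeasure ρ]
    {d : ℕ} (f : (Fin d → D) → ℝ) (hmeas : Measurable f)
    (C : ℝ) (hbd : ∀ x, |f x| ≤ C)
    (a : Fin d → D) (v w : Finset (Fin d)) (hvw : v ⊂ w) (x : Fin d → D) :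
    anchorProj a w f x - anchorProj a v f x =
      (∑ u ∈ v.powerset, ∑ u' ∈ (w \ v).powerset.filter (· ≠ ∅),
        anchorProj a w
          (fun y => ∑ u'' ∈ wᶜ.powerset, anova ρ f ((u ∪ u') ∪ u'') y) x)
      - ∑ u ∈ v.powerset,
          anchorProj a v
            (fun y => ∑ u' ∈ vᶜ.powerset.filter (fun u' => (u' ∩ w).Nonempty),
              anova ρ f (u ∪ u') y) x := by
  simp only [anchorProj]
  rw [sum_union_union_powerset hvw.subset (fun s => anova ρ f s _),
    sum_union_powerset v w (fun s => anova ρ f s _),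
    ← sum_anova ρ f fun j => if j ∈ w then x j else a j,
    ← sum_anova ρ f fun j => if j ∈ v then x j else a j,
    ← Finset.sum_sub_distrib, ← Finset.sum_sub_distrib]
  refine (Finset.sum_filter_of_ne fun s _ hs => ?_).symm
  contrapose! hs
  rw [sub_eq_zero]
  refine anova_congr ρ f s fun j hj => ?_
  have hj' : j ∉ w \ v := fun h =>
    Finset.notMem_empty j (hs ▸ Finset.mem_inter.2 ⟨hj, h⟩)
  have hvw_j : j ∈ v → j ∈ w := fun h => hvw.subset h
  grind
end
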